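/- Let n ≥ 3 be an integer and let r be a real number with n-2 ≤ r < n-1. Then M_{n,r} is homeomorphic to the unit sphere S^{n-3} = {x ∈ ℝ^{n-2} : ‖x‖ = 1}. -/

import Mathlib

/-- The point `(a, b)` in the Euclidean plane. -/
noncomputable def planePt (a b : ℝ) : EuclideanSpace ℝ (Fin 2) :=
  WithLp.toLp 2 (fun j => if j = 0 then a else b)

/-- Reflection across the x-axis: `(a, b) ↦ (a, -b)`. -/
noncomputable def reflX (v : EuclideanSpace ℝ (Fin 2)) : EuclideanSpace ℝ (Fin 2) :=
  planePt (v 0) (-(v 1))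

/-- The vertices of the polygon: `x₀ = (0,0)`, `x_{n-1} = (r,0)`, and the variable
vertices `x₁, …, x_{n-2}` given by the tuple `x`. -/
noncomputable def polyVert (n : ℕ) (r : ℝ) (x : Fin (n - 2) → EuclideanSpace ℝ (Fin 2))
    (i : ℕ) : EuclideanSpace ℝ (Fin 2) :=
  if i = 0 then 0
  else if i = n - 1 then planePt r 0
  else if h : i - 1 < n - 2 then x ⟨i - 1, h⟩ else 0

/-- The moduli space `M_{n,r}` of planar `n`-gons with one side of length `r` and the
other `n-1` sides of length `1`, as a subset of `(ℝ²)^{n-2}`. -/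
def MSet (n : ℕ) (r : ℝ) : Set (Fin (n - 2) → EuclideanSpace ℝ (Fin 2)) :=
  { x | ∀ i : ℕ, 1 ≤ i → i ≤ n - 1 →
      dist (polyVert n r x (i - 1)) (polyVert n r x i) = 1 }

/-- Heights, extended by zero to all natural indices. -/
noncomputable def hExt (n : ℕ) (v : Fin (n - 2) → ℝ) (i : ℕ) : ℝ :=
  if h : i ≠ 0 ∧ i - 1 < n - 2 then v ⟨i - 1, h.2⟩ else 0

/-- The increments of the heights. -/
noncomputable def hInc (n : ℕ) (v : Fin (n - 2) → ℝ) (i : ℕ) : ℝ :=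
  hExt n v (i + 1) - hExt n v i

/-- The heights of a polygon. -/
noncomputable def hts (n : ℕ) (x : Fin (n - 2) → EuclideanSpace ℝ (Fin 2)) : Fin (n - 2) → ℝ :=
  fun j => x j 1

lemma planePt_zero (a b : ℝ) : planePt a b 0 = a := by simp [planePt]
lemma planePt_one (a b : ℝ) : planePt a b 1 = b := by simp [planePt]

lemma polyVert_one (n : ℕ) (r : ℝ) (x) (i : ℕ) (hn : 3 ≤ n) :
    polyVert n r x i 1 = hExt n (hts n x) i := by
  unfold polyVert hExt hts
  by_cases h0 : i = 0
  · simp [h0]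
  by_cases h1 : i = n - 1
  · have h2 : ¬ (i - 1 < n - 2) := by omega
    rw [if_neg h0, if_pos h1, dif_neg (by tauto), planePt_one]
  by_cases h2 : i - 1 < n - 2
  · rw [if_neg h0, if_neg h1, dif_pos h2, dif_pos ⟨h0, h2⟩]
  · rw [if_neg h0, if_neg h1, dif_neg h2, dif_neg (by tauto)]
    simp

lemma hExt_smul (n : ℕ) (t : ℝ) (v : Fin (n - 2) → ℝ) (i : ℕ) :
    hExt n (fun j => t * v j) i = t * hExt n v i := by
  unfold hExt
  split_ifs <;> simp

lemma hInc_smul (n : ℕ) (t : ℝ) (v : Fin (n - 2) → ℝ) (i : ℕ) :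
    hInc n (fun j => t * v j) i = t * hInc n v i := by
  simp only [hInc, hExt_smul]; ring

lemma hExt_eq_sum (n : ℕ) (v : Fin (n - 2) → ℝ) (i : ℕ) :
    hExt n v i = ∑ j ∈ Finset.range i, hInc n v j := by
  unfold hInc
  rw [Finset.sum_range_sub]
  simp [hExt]

lemma eq_zero_of_hInc (n : ℕ) (v : Fin (n - 2) → ℝ)
    (h : ∀ i < n - 1, hInc n v i = 0) : v = 0 := by
  funext j
  have h1 : hExt n v (j + 1) = v j := by simp [hExt]
  rw [← h1, hExt_eq_sum]
  apply Finset.sum_eq_zero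
  intro i hi
  have := Finset.mem_range.1 hi
  exact h i (by omega)

lemma mem_MSet_iff (n : ℕ) (hn : 3 ≤ n) (r : ℝ) (x) :
    x ∈ MSet n r ↔ ∀ i < n - 1,
      (polyVert n r x (i + 1) 0 - polyVert n r x i 0) ^ 2 + (hInc n (hts n x) i) ^ 2 = 1 := by
  have key : ∀ i, dist (polyVert n r x i) (polyVert n r x (i + 1)) = 1 ↔
      (polyVert n r x (i + 1) 0 - polyVert n r x i 0) ^ 2 + (hInc n (hts n x) i) ^ 2 = 1 := by
    intro i
    rw [EuclideanSpace.dist_eq, Fin.sum_univ_two, Real.dist_eq, Real.dist_eq, sq_abs, sq_abs,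
      Real.sqrt_eq_one, polyVert_one _ _ _ _ hn, polyVert_one _ _ _ _ hn]
    unfold hInc
    constructor <;> intro h <;> nlinarith
  constructor
  · intro h i hi
    exact (key i).1 (by simpa using h (i + 1) (by omega) (by omega))
  · intro h i hi1 hi2
    obtain ⟨j, rfl⟩ : ∃ j, i = j + 1 := ⟨i - 1, by omega⟩
    exact (key j).2 (h j (by omega))

lemma nonneg_of_sum (m : ℕ) (d : ℕ → ℝ) (hd : ∀ i < m, d i ≤ 1)
    (hs : (m : ℝ) - 1 ≤ ∑ i ∈ Finset.range m, d i) (i : ℕ) (hi : i < m) : 0 ≤ d i := by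
  have hm : i ∈ Finset.range m := Finset.mem_range.2 hi
  have h1 := Finset.add_sum_erase _ d hm
  have h2 : ∑ j ∈ (Finset.range m).erase i, d j ≤ ∑ j ∈ (Finset.range m).erase i, (1 : ℝ) :=
    Finset.sum_le_sum fun j hj => hd j (Finset.mem_range.1 (Finset.mem_of_mem_erase hj))
  rw [Finset.sum_const, Finset.card_erase_of_mem hm, Finset.card_range, nsmul_eq_mul,
    Nat.cast_sub (by omega)] at h2
  push_cast at h2
  linarith

lemma polyVert_at_zero (n : ℕ) (r : ℝ) (x) : polyVert n r x 0 = 0 := by simp [polyVert]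

lemma polyVert_at_end (n : ℕ) (hn : 3 ≤ n) (r : ℝ) (x) :
    polyVert n r x (n - 1) = planePt r 0 := by
  have : n - 1 ≠ 0 := by omega
  simp [polyVert, this]

lemma polyVert_mid (n : ℕ) (hn : 3 ≤ n) (r : ℝ) (x) (j : Fin (n - 2)) :
    polyVert n r x (j + 1) = x j := by
  have := j.2
  have h : (j : ℕ) + 1 ≠ n - 1 := by omega
  simp [polyVert, h]

lemma cast_pred' (n : ℕ) (hn : 3 ≤ n) : ((n - 1 : ℕ) : ℝ) = n - 1 := by
  rw [Nat.cast_sub (by omega)]; simp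

lemma sum_first (n : ℕ) (hn : 3 ≤ n) (r : ℝ) (x) :
    ∑ i ∈ Finset.range (n - 1), (polyVert n r x (i + 1) 0 - polyVert n r x i 0) = r := by
  rw [Finset.sum_range_sub (fun i => polyVert n r x i 0), polyVert_at_zero,
    polyVert_at_end n hn, planePt_zero]
  simp

lemma inc_first (n : ℕ) (hn : 3 ≤ n) (r : ℝ) (hr1 : (n : ℝ) - 2 ≤ r) (x) (hx : x ∈ MSet n r)
    (i : ℕ) (hi : i < n - 1) :
    polyVert n r x (i + 1) 0 - polyVert n r x i 0 = √(1 - (hInc n (hts n x) i) ^ 2) := by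
  rw [mem_MSet_iff n hn] at hx
  have h0 := nonneg_of_sum (n - 1) (fun i => polyVert n r x (i + 1) 0 - polyVert n r x i 0)
    (fun j hj => by nlinarith [hx j hj]) (by rw [sum_first n hn, cast_pred' n hn]; linarith) i hi
  rw [← hx i hi, add_sub_cancel_right, Real.sqrt_sq h0]

lemma sum_sqrt (n : ℕ) (hn : 3 ≤ n) (r : ℝ) (hr1 : (n : ℝ) - 2 ≤ r) (x) (hx : x ∈ MSet n r) :
    ∑ i ∈ Finset.range (n - 1), √(1 - (hInc n (hts n x) i) ^ 2) = r := by
  rw [← sum_first n hn r x]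
  exact Finset.sum_congr rfl fun i hi =>
    (inc_first n hn r hr1 x hx i (Finset.mem_range.1 hi)).symm

lemma hts_ne_zero (n : ℕ) (hn : 3 ≤ n) (r : ℝ) (hr1 : (n : ℝ) - 2 ≤ r) (hr2 : r < (n : ℝ) - 1)
    (x) (hx : x ∈ MSet n r) : hts n x ≠ 0 := by
  intro h
  have h1 := sum_sqrt n hn r hr1 x hx
  have h2 : ∀ i, hInc n (0 : Fin (n - 2) → ℝ) i = 0 := by intro i; simp [hInc, hExt]
  rw [h] at h1
  simp [h2, cast_pred' n hn] at h1
  linarith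

lemma hts_inj (n : ℕ) (hn : 3 ≤ n) (r : ℝ) (hr1 : (n : ℝ) - 2 ≤ r)
    (x) (hx : x ∈ MSet n r) (y) (hy : y ∈ MSet n r) (h : hts n x = hts n y) : x = y := by
  have h1 : ∀ i ≤ n - 1, polyVert n r x i 0 = polyVert n r y i 0 := by
    intro i
    induction i with
    | zero => intro _; simp [polyVert_at_zero]
    | succ k ih =>
      intro hk
      have a := inc_first n hn r hr1 x hx k (by omega)
      have b := inc_first n hn r hr1 y hy k (by omega)
      rw [h] at a
      have := ih (by omega)
      linarith
  funext j
  ext l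
  have hj := j.2
  fin_cases l
  · have := h1 (j + 1) (by omega)
    rw [polyVert_mid n hn, polyVert_mid n hn] at this
    exact this
  · exact congrFun h j

lemma scale_le (n : ℕ) (hn : 3 ≤ n) (r : ℝ) (hr1 : (n : ℝ) - 2 ≤ r) (hr2 : r < (n : ℝ) - 1)
    (x) (hx : x ∈ MSet n r) (y) (hy : y ∈ MSet n r) (t : ℝ) (ht0 : 0 ≤ t)
    (h : hts n y = fun j => t * hts n x j) : 1 ≤ t := by
  by_contra! ht
  apply hts_ne_zero n hn r hr1 hr2 x hx
  apply eq_zero_of_hInc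
  have hx' := (mem_MSet_iff n hn r x).1 hx
  have sx := sum_sqrt n hn r hr1 x hx
  have sy := sum_sqrt n hn r hr1 y hy
  rw [h] at sy
  simp only [hInc_smul] at sy
  by_contra! hne
  obtain ⟨i, hi, hi0⟩ := hne
  have aux : ∀ j, (t * hInc n (hts n x) j) ^ 2 ≤ (hInc n (hts n x) j) ^ 2 := by
    intro j
    rw [mul_pow]
    have : t ^ 2 ≤ 1 := by nlinarith
    nlinarith [sq_nonneg (hInc n (hts n x) j)]
  have : ∑ j ∈ Finset.range (n - 1), √(1 - (hInc n (hts n x) j) ^ 2)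
      < ∑ j ∈ Finset.range (n - 1), √(1 - (t * hInc n (hts n x) j) ^ 2) := by
    apply Finset.sum_lt_sum
    · intro j _
      exact Real.sqrt_le_sqrt (by linarith [aux j])
    · refine ⟨i, Finset.mem_range.2 hi, Real.sqrt_lt_sqrt ?_ ?_⟩
      · nlinarith [hx' i hi, sq_nonneg (polyVert n r x (i + 1) 0 - polyVert n r x i 0)]
      · have : t ^ 2 < 1 := by nlinarith
        have h3 : 0 < (hInc n (hts n x) i) ^ 2 := by positivity
        rw [mul_pow]
        nlinarith
  linarith

lemma exists_scale (n : ℕ) (hn : 3 ≤ n) (r : ℝ) (hr1 : (n : ℝ) - 2 ≤ r) (hr2 : r < (n : ℝ) - 1)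
    (v : Fin (n - 2) → ℝ) (hv : v ≠ 0) : ∃ t : ℝ, 0 < t ∧
      (∀ i < n - 1, (t * hInc n v i) ^ 2 ≤ 1) ∧
      ∑ i ∈ Finset.range (n - 1), √(1 - (t * hInc n v i) ^ 2) = r := by
  obtain ⟨k, hk, hmax⟩ := Finset.exists_max_image (Finset.range (n - 1)) (fun i => |hInc n v i|)
    ⟨0, Finset.mem_range.2 (by omega)⟩
  have hpos : 0 < |hInc n v k| := by
    by_contra! hle
    apply hv
    apply eq_zero_of_hInc
    intro i hi
    exact abs_eq_zero.1 (le_antisymm ((hmax i (Finset.mem_range.2 hi)).trans hle) (abs_nonneg _))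
  set c := |hInc n v k| with hc
  set g : ℝ → ℝ := fun t => ∑ i ∈ Finset.range (n - 1), √(1 - (t * hInc n v i) ^ 2) with hg
  have hcont : Continuous g := by
    apply continuous_finsetSum
    intro i _
    fun_prop
  have g0 : g 0 = n - 1 := by simp [hg, cast_pred' n hn]
  have gT : g c⁻¹ ≤ n - 2 := by
    have h1 := Finset.add_sum_erase _ (fun i => √(1 - (c⁻¹ * hInc n v i) ^ 2)) hk
    have h2 : ∑ j ∈ (Finset.range (n - 1)).erase k, √(1 - (c⁻¹ * hInc n v j) ^ 2)
        ≤ ∑ j ∈ (Finset.range (n - 1)).erase k, (1 : ℝ) :=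
      Finset.sum_le_sum fun j hj => by
        rw [Real.sqrt_le_one]
        nlinarith [sq_nonneg (c⁻¹ * hInc n v j)]
    rw [Finset.sum_const, Finset.card_erase_of_mem hk, Finset.card_range, nsmul_eq_mul,
      Nat.cast_sub (by omega), cast_pred' n hn] at h2
    push_cast at h2
    have h3 : (c⁻¹ * hInc n v k) ^ 2 = 1 := by
      rw [mul_pow, ← sq_abs (hInc n v k), ← hc, ← mul_pow, inv_mul_cancel₀ hpos.ne', one_pow]
    simp only [h3, sub_self, Real.sqrt_zero] at h1
    simp only [hg]
    linarith
  have hT : 0 ≤ c⁻¹ := by positivity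
  obtain ⟨t, ⟨ht0, ht1⟩, ht⟩ := intermediate_value_Icc' hT hcont.continuousOn
    (show r ∈ Set.Icc (g c⁻¹) (g 0) from ⟨by linarith, by linarith⟩)
  refine ⟨t, lt_of_le_of_ne ht0 ?_, ?_, ht⟩
  · rintro rfl
    linarith
  · intro i hi
    rw [sq_le_one_iff_abs_le_one, abs_mul, abs_of_nonneg ht0]
    calc t * |hInc n v i| ≤ c⁻¹ * c :=
          mul_le_mul ht1 (hmax i (Finset.mem_range.2 hi)) (abs_nonneg _) hT
      _ = 1 := inv_mul_cancel₀ hpos.ne'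

lemma exists_poly (n : ℕ) (hn : 3 ≤ n) (r : ℝ) (w : Fin (n - 2) → ℝ)
    (h1 : ∀ i < n - 1, (hInc n w i) ^ 2 ≤ 1)
    (h2 : ∑ i ∈ Finset.range (n - 1), √(1 - (hInc n w i) ^ 2) = r) :
    ∃ x ∈ MSet n r, hts n x = w := by
  let a : ℕ → ℝ := fun k => ∑ i ∈ Finset.range k, √(1 - (hInc n w i) ^ 2)
  let x : Fin (n - 2) → EuclideanSpace ℝ (Fin 2) := fun j => planePt (a (j + 1)) (w j)
  have hw : hts n x = w := by
    funext j
    simp [hts, x, planePt_one]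
  have ha : ∀ i ≤ n - 1, polyVert n r x i 0 = a i := by
    intro i hi
    by_cases h0 : i = 0
    · subst h0; simp [polyVert_at_zero, a]
    by_cases h3 : i = n - 1
    · rw [h3, polyVert_at_end n hn, planePt_zero]; exact h2.symm
    · have := polyVert_mid n hn r x ⟨i - 1, by omega⟩
      simp only [Nat.sub_add_cancel (Nat.one_le_iff_ne_zero.2 h0), x] at this
      rw [this, planePt_zero]
  refine ⟨x, ?_, hw⟩
  rw [mem_MSet_iff n hn]
  intro i hi
  rw [ha _ (by omega), ha _ (by omega), hw]
  have : a (i + 1) - a i = √(1 - (hInc n w i) ^ 2) := by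
    simp [a, Finset.sum_range_succ]
  rw [this, Real.sq_sqrt (by linarith [h1 i hi])]
  ring

lemma continuous_polyVert (n : ℕ) (r : ℝ) (i : ℕ) : Continuous fun x => polyVert n r x i := by
  unfold polyVert
  split_ifs <;> fun_prop

lemma isCompact_MSet (n : ℕ) (hn : 3 ≤ n) (r : ℝ) : IsCompact (MSet n r) := by
  apply Metric.isCompact_of_isClosed_isBounded
  · have : MSet n r = ⋂ i : ℕ, ⋂ (_ : 1 ≤ i), ⋂ (_ : i ≤ n - 1),
        {x | dist (polyVert n r x (i - 1)) (polyVert n r x i) = 1} := by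
      ext x; simp [MSet]
    rw [this]
    refine isClosed_iInter fun i => isClosed_iInter fun _ => isClosed_iInter fun _ => ?_
    exact isClosed_eq ((continuous_polyVert n r _).dist (continuous_polyVert n r _))
      continuous_const
  · refine (Metric.isBounded_closedBall (x := 0) (r := (n : ℝ))).subset ?_
    intro x hx
    rw [mem_closedBall_zero_iff, pi_norm_le_iff_of_nonneg (by positivity)]
    have h : ∀ i ≤ n - 1, ‖polyVert n r x i‖ ≤ i := by
      intro i
      induction i with
      | zero => intro _; simp [polyVert_at_zero]
      | succ k ih =>
        intro hk
        have h1 := hx (k + 1) (by omega) hk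
        rw [Nat.add_sub_cancel, dist_comm, dist_eq_norm] at h1
        have h2 := norm_le_norm_add_norm_sub' (polyVert n r x (k + 1)) (polyVert n r x k)
        have h3 := ih (by omega)
        push_cast
        linarith
    intro j
    have hj := j.2
    rw [← polyVert_mid n hn r x j]
    refine (h _ (by omega)).trans ?_
    exact_mod_cast (by omega)

/-- For `n ≥ 3` and `n-2 ≤ r < n-1`, the space `M_{n,r}` is homeomorphic
to the unit sphere `S^{n-3} = {x ∈ ℝ^{n-2} : ‖x‖ = 1}`. -/
theorem polygon_space_homeo_sphere
    (n : ℕ) (hn : 3 ≤ n) (r : ℝ) (hr1 : (n : ℝ) - 2 ≤ r) (hr2 : r < (n : ℝ) - 1) :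
    Nonempty ((MSet n r) ≃ₜ (Metric.sphere (0 : EuclideanSpace ℝ (Fin (n - 2))) 1)) := by
  have : CompactSpace (MSet n r) := isCompact_iff_compactSpace.1 (isCompact_MSet n hn r)
  let H : MSet n r → EuclideanSpace ℝ (Fin (n - 2)) := fun x => WithLp.toLp 2 (hts n x.1)
  have hH0 : ∀ x, H x ≠ 0 := by
    intro x h
    apply hts_ne_zero n hn r hr1 hr2 x.1 x.2
    simpa [H] using h
  have hHc : Continuous H := by
    have : Continuous fun x : MSet n r => hts n x.1 := by
      refine continuous_pi fun j => ?_
      exact (EuclideanSpace.proj (𝕜 := ℝ) (1 : Fin 2)).continuous.comp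
        ((continuous_apply j).comp continuous_subtype_val)
    exact (PiLp.continuous_toLp 2 _).comp this
  let F : MSet n r → Metric.sphere (0 : EuclideanSpace ℝ (Fin (n - 2))) 1 :=
    fun x => ⟨‖H x‖⁻¹ • H x, by
      rw [mem_sphere_zero_iff_norm, norm_smul, norm_inv, norm_norm,
        inv_mul_cancel₀ (norm_ne_zero_iff.2 (hH0 x))]⟩
  have hFc : Continuous F :=
    ((hHc.norm.inv₀ fun x => norm_ne_zero_iff.2 (hH0 x)).smul hHc).subtype_mk _
  have hinj : Function.Injective F := by
    intro x y hxy
    have h1 : ‖H x‖⁻¹ • H x = ‖H y‖⁻¹ • H y := congrArg Subtype.val hxy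
    have key : ∀ x y : MSet n r, ‖H x‖⁻¹ • H x = ‖H y‖⁻¹ • H y → ‖H x‖ ≤ ‖H y‖ := by
      intro x y h
      have hx := norm_pos_iff.2 (hH0 x)
      have hy := norm_pos_iff.2 (hH0 y)
      have h2 : H y = (‖H y‖ * ‖H x‖⁻¹) • H x := by
        rw [mul_smul, h, smul_smul, mul_inv_cancel₀ hy.ne', one_smul]
      have h3 := scale_le n hn r hr1 hr2 x.1 x.2 y.1 y.2 (‖H y‖ * ‖H x‖⁻¹) (by positivity) (by
        funext j
        exact congrArg (fun v : EuclideanSpace ℝ (Fin (n - 2)) => v j) h2)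
      rw [← div_eq_mul_inv, one_le_div hx] at h3
      exact h3
    have h2 : ‖H x‖ = ‖H y‖ := le_antisymm (key x y h1) (key y x h1.symm)
    rw [h2] at h1
    have h3 : H x = H y :=
      smul_right_injective _ (inv_ne_zero (norm_ne_zero_iff.2 (hH0 y))) h1
    apply Subtype.ext
    apply hts_inj n hn r hr1 x.1 x.2 y.1 y.2
    exact congrArg WithLp.ofLp h3
  have hsurj : Function.Surjective F := by
    rintro ⟨v, hv⟩
    rw [mem_sphere_zero_iff_norm] at hv
    have hv0 : (WithLp.ofLp v) ≠ 0 := by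
      intro h
      have : v = 0 := by
        ext j; exact congrFun h j
      rw [this] at hv
      simp at hv
    obtain ⟨t, ht, h1, h2⟩ := exists_scale n hn r hr1 hr2 (WithLp.ofLp v) hv0
    obtain ⟨x, hx, hxw⟩ := exists_poly n hn r (fun j => t * v j)
      (by simpa only [hInc_smul] using h1) (by simpa only [hInc_smul] using h2)
    refine ⟨⟨x, hx⟩, Subtype.ext ?_⟩
    have h3 : H ⟨x, hx⟩ = t • v := by
      ext j
      exact congrFun hxw j
    change ‖H ⟨x, hx⟩‖⁻¹ • H ⟨x, hx⟩ = v
    rw [h3, norm_smul, hv, mul_one, Real.norm_of_nonneg ht.le, smul_smul, inv_mul_cancel₀ ht.ne',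
      one_smul]
  exact ⟨Continuous.homeoOfEquivCompactToT2 (f := Equiv.ofBijective F ⟨hinj, hsurj⟩) hFc⟩
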